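/- arXiv:2308.12764 — 3 statements merged into one kernel-verified Lean document; each statement's English description precedes it below -/
import Mathlib

section
/- Let ν > 0 and let α ∈ (0,1). Then tanh(√(1/ν)·(1−α))·coth(√(1/ν)·α) < 1 if and only if α > 1/2. (This is the convergence factor of the Dirichlet–Neumann method with relaxation parameter θ = 1 applied to the reduced optimality system −ν y'' + y = ŷ on (0,1): the method converges if and only if the interface α is closer to the right boundary.) -/
open Real

/-- `coth x = cosh x / sinh x`. -/
noncomputable def coth (x : ℝ) : ℝ := Real.cosh x / Real.sinh x

theorem tanh_mul_coth_lt_one_iff {a b : ℝ} (ha : 0 < a) :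
    Real.tanh b * coth a < 1 ↔ b < a := by
  have hs : 0 < Real.sinh a := Real.sinh_pos_iff.mpr ha
  have hc : 0 < Real.cosh b := Real.cosh_pos b
  rw [coth, Real.tanh_eq_sinh_div_cosh, div_mul_div_comm, div_lt_one (mul_pos hc hs),
    ← sub_neg, ← Real.sinh_sub, Real.sinh_neg_iff, sub_neg]

/-- The DN method with `θ = 1` applied to `-ν y'' + y = ŷ` on `(0,1)` converges
iff the interface `α` is closer to the right boundary, i.e. `α > 1/2`. -/
theorem dn_theta_one_converges_iff (ν α : ℝ) (hν : 0 < ν) (hα : α ∈ Set.Ioo (0:ℝ) 1) :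
    Real.tanh (Real.sqrt (1 / ν) * (1 - α)) * coth (Real.sqrt (1 / ν) * α) < 1 ↔ 1 / 2 < α := by
  have hσ : 0 < Real.sqrt (1 / ν) := Real.sqrt_pos.mpr (one_div_pos.mpr hν)
  rw [tanh_mul_coth_lt_one_iff (mul_pos hσ hα.1), mul_lt_mul_iff_right₀ hσ]
  constructor <;> intro h <;> linarith
end

section
/- Let λ > 0, α ∈ (0,1) and g ∈ ℝ. Suppose e₁, e₂ : ℝ → ℝ are twice differentiable and satisfy e₁''(x) = λ·e₁(x) for all x ∈ [0,α] with e₁(0) = 0 and e₁(α) = g, and e₂''(x) = λ·e₂(x) for all x ∈ [α,1] with e₂(1) = 0 and e₂'(α) = e₁'(α). Then e₂(α) = −g·tanh(√λ·(1−α))·coth(√λ·α). Consequently, one step of the Dirichlet–Neumann iteration with relaxation parameter θ maps the interface value g to (1−θ)g + θ·e₂(α) = (1 − θ(1 + tanh(√λ(1−α))·coth(√λα)))·g. -/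
open Real

/-- If `f'' = k² f` on `[a,b]`, the Wronskian of `f` and `x ↦ sinh (k (x - c))` takes the same
value at both end points. -/
theorem wronskian_sinh_eq {f : ℝ → ℝ} {a b k : ℝ} (c : ℝ) (hab : a ≤ b)
    (hf : Differentiable ℝ f) (hf' : Differentiable ℝ (deriv f))
    (hode : ∀ x ∈ Set.Icc a b, deriv (deriv f) x = k ^ 2 * f x) :
    deriv f b * Real.sinh (k * (b - c)) - k * f b * Real.cosh (k * (b - c)) =
      deriv f a * Real.sinh (k * (a - c)) - k * f a * Real.cosh (k * (a - c)) := by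
  have hderiv : ∀ x, HasDerivAt
      (fun x => deriv f x * Real.sinh (k * (x - c)) - k * f x * Real.cosh (k * (x - c)))
      ((deriv (deriv f) x - k ^ 2 * f x) * Real.sinh (k * (x - c))) x := by
    intro x
    have hlin : HasDerivAt (fun x : ℝ => k * (x - c)) (k * 1) x :=
      ((hasDerivAt_id x).sub_const c).const_mul k
    refine (((hf' x).hasDerivAt.mul hlin.sinh).sub
      (((hf x).hasDerivAt.const_mul k).mul hlin.cosh)).congr_deriv ?_
    ring
  refine constant_of_has_deriv_right_zero
    (f := fun x => deriv f x * Real.sinh (k * (x - c)) - k * f x * Real.cosh (k * (x - c)))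
    (fun x _ => (hderiv x).continuousAt.continuousWithinAt) (fun x hx => ?_)
    b (Set.right_mem_Icc.2 hab)
  have h := (hderiv x).hasDerivWithinAt (s := Set.Ici x)
  rwa [hode x (Set.Ico_subset_Icc_self hx), sub_self, zero_mul] at h

/-- One step of the Dirichlet–Neumann iteration: if `e₁` solves the Dirichlet
problem on `[0,α]` with interface value `g` and `e₂` solves the Neumann problem on
`[α,1]` with flux matching, then `e₂(α) = -g·tanh(√λ(1-α))·coth(√λα)`, and the DN
update maps `g` to `(1 - θ(1 + tanh(√λ(1-α))·coth(√λα)))·g`. -/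
theorem dn_one_step (l α g θ : ℝ) (hl : 0 < l) (hα : α ∈ Set.Ioo (0:ℝ) 1)
    (e₁ e₂ : ℝ → ℝ)
    (he₁ : Differentiable ℝ e₁) (he₁' : Differentiable ℝ (deriv e₁))
    (he₂ : Differentiable ℝ e₂) (he₂' : Differentiable ℝ (deriv e₂))
    (hode₁ : ∀ x ∈ Set.Icc 0 α, deriv (deriv e₁) x = l * e₁ x)
    (h₁0 : e₁ 0 = 0) (h₁α : e₁ α = g)
    (hode₂ : ∀ x ∈ Set.Icc α 1, deriv (deriv e₂) x = l * e₂ x)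
    (h₂1 : e₂ 1 = 0) (hflux : deriv e₂ α = deriv e₁ α) :
    e₂ α = -g * Real.tanh (Real.sqrt l * (1 - α)) * coth (Real.sqrt l * α) ∧
    (1 - θ) * g + θ * e₂ α
      = (1 - θ * (1 + Real.tanh (Real.sqrt l * (1 - α)) * coth (Real.sqrt l * α))) * g := by
  obtain ⟨hα0, hα1⟩ := hα
  have hk : 0 < Real.sqrt l := Real.sqrt_pos.2 hl
  have hsq : Real.sqrt l ^ 2 = l := Real.sq_sqrt hl.le
  set k := Real.sqrt l
  have h₁ := wronskian_sinh_eq (k := k) 0 hα0.le he₁ he₁' (by rwa [hsq])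
  have h₂ := wronskian_sinh_eq (k := k) 1 hα1.le he₂ he₂' (by rwa [hsq])
  rw [← neg_sub 1 α, mul_neg, Real.sinh_neg, Real.cosh_neg] at h₂
  simp only [h₁0, h₁α, h₂1, hflux, sub_zero, sub_self, mul_zero, zero_mul, Real.sinh_zero]
    at h₁ h₂
  have hs : Real.sinh (k * α) ≠ 0 := (Real.sinh_pos_iff.2 (mul_pos hk hα0)).ne'
  have hc : Real.cosh (k * (1 - α)) ≠ 0 := (Real.cosh_pos _).ne'
  have key : e₂ α = -g * Real.tanh (k * (1 - α)) * coth (k * α) := by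
    rw [coth, Real.tanh_eq_sinh_div_cosh]
    field_simp
    apply mul_left_cancel₀ hk.ne'
    linear_combination Real.sinh (k * α) * h₂ - Real.sinh (k * (1 - α)) * h₁
  refine ⟨key, ?_⟩
  rw [key]
  ring
end

section
/- Let α ∈ (0,1). Then (tanh(s·α) + tanh(s·(1−α)))·(coth(s·α) + coth(s·(1−α))) tends to 4 as s → ∞. Consequently, for fixed θ, the Neumann–Neumann mode factor |1 − θ·(tanh(σ_k α) + tanh(σ_k(1−α)))·(coth(σ_k α) + coth(σ_k(1−α)))| with σ_k = √(k²π² + 1/ν) tends to |1 − 4θ| as k → ∞. -/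
open Real Filter

theorem tendsto_tanh_atTop_one : Tendsto Real.tanh atTop (nhds 1) := by
  have hexp : Tendsto (fun x : ℝ => Real.exp (-x) ^ 2) atTop (nhds 0) := by
    simpa using Real.tendsto_exp_neg_atTop_nhds_zero.pow 2
  have h : Tendsto (fun x : ℝ => (1 - Real.exp (-x) ^ 2) / (1 + Real.exp (-x) ^ 2))
      atTop (nhds 1) := by
    simpa [Pi.div_def] using (hexp.const_sub 1).div (hexp.const_add 1) (by norm_num)
  refine h.congr fun x => ?_
  have hx : Real.exp x * Real.exp (-x) = 1 := by rw [← Real.exp_add]; simp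
  rw [Real.tanh_eq, div_eq_div_iff (by positivity) (by positivity)]
  linear_combination (-2 * Real.exp (-x)) * hx

theorem coth_eq_inv_tanh (x : ℝ) : coth x = (Real.tanh x)⁻¹ := by
  rw [coth, Real.tanh_eq_sinh_div_cosh, inv_div]

theorem tendsto_coth_atTop_one : Tendsto coth atTop (nhds 1) := by
  simpa [← coth_eq_inv_tanh] using tendsto_tanh_atTop_one.inv₀ one_ne_zero

theorem tendsto_sqrt_natCast_sq_mul_add_atTop {a : ℝ} (ha : 0 < a) (c : ℝ) :
    Tendsto (fun k : ℕ => Real.sqrt ((k : ℝ) ^ 2 * a + c)) atTop atTop :=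
  Real.tendsto_sqrt_atTop.comp <| tendsto_atTop_add_const_right _ _ <|
    ((tendsto_pow_atTop two_ne_zero).comp tendsto_natCast_atTop_atTop).atTop_mul_const ha

/-- `(tanh(sα)+tanh(s(1-α)))·(coth(sα)+coth(s(1-α))) → 4` as `s → ∞`; consequently
the NN mode factor with `σ_k = √(k²π² + 1/ν)` tends to `|1 - 4θ|` as `k → ∞`. -/
theorem nn_high_frequency_limit (α : ℝ) (hα : α ∈ Set.Ioo (0:ℝ) 1) :
    Tendsto (fun s : ℝ => (Real.tanh (s * α) + Real.tanh (s * (1 - α))) *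
        (coth (s * α) + coth (s * (1 - α)))) atTop (nhds 4) ∧
    ∀ θ ν : ℝ, 0 < ν →
      Tendsto (fun k : ℕ =>
          |1 - θ * (Real.tanh (Real.sqrt ((k : ℝ) ^ 2 * π ^ 2 + 1 / ν) * α) +
              Real.tanh (Real.sqrt ((k : ℝ) ^ 2 * π ^ 2 + 1 / ν) * (1 - α))) *
            (coth (Real.sqrt ((k : ℝ) ^ 2 * π ^ 2 + 1 / ν) * α) +
              coth (Real.sqrt ((k : ℝ) ^ 2 * π ^ 2 + 1 / ν) * (1 - α)))|)
        atTop (nhds |1 - 4 * θ|) := by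
  have hl : Tendsto (fun s : ℝ => s * α) atTop atTop := tendsto_id.atTop_mul_const hα.1
  have hr : Tendsto (fun s : ℝ => s * (1 - α)) atTop atTop :=
    tendsto_id.atTop_mul_const (sub_pos.2 hα.2)
  have key : Tendsto (fun s : ℝ => (Real.tanh (s * α) + Real.tanh (s * (1 - α))) *
      (coth (s * α) + coth (s * (1 - α)))) atTop (nhds 4) := by
    have h := ((tendsto_tanh_atTop_one.comp hl).add (tendsto_tanh_atTop_one.comp hr)).mul
      ((tendsto_coth_atTop_one.comp hl).add (tendsto_coth_atTop_one.comp hr))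
    norm_num at h
    exact h
  refine ⟨key, fun θ ν _ => ?_⟩
  have hσ := tendsto_sqrt_natCast_sq_mul_add_atTop (pow_pos Real.pi_pos 2) (1 / ν)
  have h := (((key.comp hσ).const_mul θ).const_sub 1).abs
  rw [mul_comm θ 4] at h
  simpa only [Function.comp_def, mul_assoc] using h
end
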